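/- arXiv:q-alg/9703014 — 2 statements merged into one kernel-verified Lean document; each statement's English description precedes it below -/
import Mathlib

section
/- In case 2), let g = (1/2)·[[2-c², 0, 0, -c²], [0, -2, 0, 0], [0, 0, -2, 0], [-c², 0, 0, -2-c²]] and let R be defined as above (for either value of s ∈ {1,-1}; R does not depend on s). For a,b ∈ ℂ, the deformed Clifford relations γ^i γ^j + Σ_{k,l=0}^{3} R^{ji}_{lk} γ^k γ^l = 2 g^{ji}·1₄ hold for all i,j ∈ {0,1,2,3} if and only if ab = 1. -/
open Matrix Complex Kronecker

noncomputable section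

/-- The Pauli matrices σ₀, σ₁, σ₂, σ₃ (indices A,B ∈ {1,2} become 0,1). -/
def pauli : Fin 4 → Matrix (Fin 2) (Fin 2) ℂ :=
  ![!![1, 0; 0, 1], !![0, 1; 1, 0], !![0, -I; I, 0], !![1, 0; 0, -1]]

/-- The matrix V, V^{AB}_i = (σ_i)_{AB}. -/
def Vmat : Matrix (Fin 2 × Fin 2) (Fin 4) ℂ :=
  Matrix.of fun p i => pauli i p.1 p.2

/-- The matrix V⁻¹, (V⁻¹)^i_{AB} = ½ (σ_i)_{BA}. -/
def Vinv : Matrix (Fin 4) (Fin 2 × Fin 2) ℂ :=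
  Matrix.of fun i p => (1 / 2 : ℂ) * pauli i p.2 p.1

/-- Identification of the ordered basis e₁⊗e₁, e₁⊗e₂, e₂⊗e₁, e₂⊗e₂ of ℂ²⊗ℂ²
with the indices 0,1,2,3. -/
def pidx (p : Fin 2 × Fin 2) : Fin 4 :=
  ⟨2 * p.1.val + p.2.val, by have := p.1.isLt; have := p.2.isLt; omega⟩

/-- Reading a 4×4 matrix as a matrix on ℂ²⊗ℂ² (w.r.t. the basis order above). -/
def toPair (Q : Matrix (Fin 4) (Fin 4) ℂ) : Matrix (Fin 2 × Fin 2) (Fin 2 × Fin 2) ℂ :=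
  Matrix.of fun p p' => Q (pidx p) (pidx p')

/-- The flip τ(u⊗v) = v⊗u on ℂ²⊗ℂ² as a 4×4 matrix. -/
def flipM : Matrix (Fin 2 × Fin 2) (Fin 2 × Fin 2) ℂ :=
  Matrix.of fun p p' => if p.1 = p'.2 ∧ p.2 = p'.1 then 1 else 0

/-- L = s q^{1/2} (1₄ + q E E'), where `Ev` is the column vector E and `Ep` the row covector E'. -/
def Lmat (s sqrtq q : ℂ) (Ev Ep : Fin 2 × Fin 2 → ℂ) :
    Matrix (Fin 2 × Fin 2) (Fin 2 × Fin 2) ℂ :=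
  Matrix.of fun p p' => s * sqrtq * ((if p = p' then 1 else 0) + q * Ev p * Ep p')

/-- 1₂⊗Y⊗1₂, acting on the middle two tensor factors of ℂ²⊗ℂ²⊗ℂ²⊗ℂ². -/
def midX (Y : Matrix (Fin 2 × Fin 2) (Fin 2 × Fin 2) ℂ) :
    Matrix ((Fin 2 × Fin 2) × (Fin 2 × Fin 2)) ((Fin 2 × Fin 2) × (Fin 2 × Fin 2)) ℂ :=
  Matrix.of fun p p' =>
    (if p.1.1 = p'.1.1 then 1 else 0) * Y (p.1.2, p.2.1) (p'.1.2, p'.2.1) *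
      (if p.2.2 = p'.2.2 then 1 else 0)

/-- R = (V⁻¹⊗V⁻¹)(1₂⊗X⊗1₂)(L⊗L̃)(1₂⊗X⁻¹⊗1₂)(V⊗V), with L̃ = q τ L τ. -/
def Rmat (s sqrtq q : ℂ) (Ev Ep : Fin 2 × Fin 2 → ℂ)
    (X : Matrix (Fin 2 × Fin 2) (Fin 2 × Fin 2) ℂ) :
    Matrix (Fin 4 × Fin 4) (Fin 4 × Fin 4) ℂ :=
  (Vinv ⊗ₖ Vinv) * midX X *
    (Lmat s sqrtq q Ev Ep ⊗ₖ (q • (flipM * Lmat s sqrtq q Ev Ep * flipM))) *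
    midX X⁻¹ * (Vmat ⊗ₖ Vmat)

/-- A_i = q^{-1/2} Eᵀ (σ_i∘D) E, where D = τX⁻¹τ, (σ_i∘D)_{KL} = Σ_{A,B}(σ_i)_{AB} D^{AB}_{KL},
and `invsqrtq` denotes q^{-1/2}. -/
def Amat (invsqrtq : ℂ) (E : Matrix (Fin 2) (Fin 2) ℂ)
    (X : Matrix (Fin 2 × Fin 2) (Fin 2 × Fin 2) ℂ) (i : Fin 4) : Matrix (Fin 2) (Fin 2) ℂ :=
  invsqrtq • (E.transpose *
    (Matrix.of fun K L => ∑ A : Fin 2, ∑ B : Fin 2,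
      pauli i A B * (flipM * X⁻¹ * flipM) (A, B) (K, L)) * E)

/-- The gamma matrices γ^i = [[0, b A_i],[a σ_i, 0]] as block matrices on ℂ² ⊕ ℂ². -/
def gam (a b invsqrtq : ℂ) (E : Matrix (Fin 2) (Fin 2) ℂ)
    (X : Matrix (Fin 2 × Fin 2) (Fin 2 × Fin 2) ℂ) (i : Fin 4) :
    Matrix (Fin 2 ⊕ Fin 2) (Fin 2 ⊕ Fin 2) ℂ :=
  Matrix.fromBlocks 0 (b • Amat invsqrtq E X i) (a • pauli i) 0

/-- The flip plus `t` times the elementary matrix at row `(0, 0)` and column `(1, 1)`. -/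
def twist (t : ℂ) : Matrix (Fin 2 × Fin 2) (Fin 2 × Fin 2) ℂ :=
  flipM + Matrix.single (0, 0) (1, 1) t

lemma flipM_mul_toPair (t : ℂ) :
    flipM * toPair !![1, 0, 0, t; 0, 1, 0, 0; 0, 0, 1, 0; 0, 0, 0, 1] = twist t := by
  ext ⟨A, B⟩ ⟨C, D⟩
  fin_cases A <;> fin_cases B <;> fin_cases C <;> fin_cases D <;>
    simp [twist, flipM, toPair, pidx, Matrix.mul_apply, Fintype.sum_prod_type]

lemma twist_mul_twist_neg (t : ℂ) : twist t * twist (-t) = 1 := by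
  ext ⟨A, B⟩ ⟨C, D⟩
  fin_cases A <;> fin_cases B <;> fin_cases C <;> fin_cases D <;>
    simp [twist, flipM, Matrix.mul_apply, Fintype.sum_prod_type, Matrix.single_apply]

lemma twist_inv (t : ℂ) : (twist t)⁻¹ = twist (-t) :=
  Matrix.inv_eq_right_inv (twist_mul_twist_neg t)

lemma Lmat_eq_smul_flipM (s : ℂ) :
    Lmat s 1 1 (fun p => !![0, 1; -1, 0] p.1 p.2) (fun p => !![0, -1; 1, 0] p.1 p.2) =
      s • flipM := by
  ext ⟨A, B⟩ ⟨C, D⟩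
  fin_cases A <;> fin_cases B <;> fin_cases C <;> fin_cases D <;> simp [Lmat, flipM]

lemma flipM_mul_flipM : flipM * flipM = 1 := by
  ext ⟨A, B⟩ ⟨C, D⟩
  fin_cases A <;> fin_cases B <;> fin_cases C <;> fin_cases D <;>
    simp [flipM, Matrix.mul_apply, Fintype.sum_prod_type]

lemma mul_flipM_kronecker_apply {ι : Type*}
    (M : Matrix ι ((Fin 2 × Fin 2) × (Fin 2 × Fin 2)) ℂ) (r : ι) (A B C D : Fin 2) :
    (M * (flipM ⊗ₖ flipM)) r ((A, B), (C, D)) = M r ((B, A), (D, C)) := by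
  simp only [Matrix.mul_apply, Fintype.sum_prod_type, Matrix.kroneckerMap_apply, flipM,
    Matrix.of_apply]
  fin_cases A <;> fin_cases B <;> fin_cases C <;> fin_cases D <;> simp

lemma Vinv_kronecker_mul_midX_apply (Y : Matrix (Fin 2 × Fin 2) (Fin 2 × Fin 2) ℂ)
    (i j : Fin 4) (A B C D : Fin 2) :
    ((Vinv ⊗ₖ Vinv) * midX Y) (i, j) ((A, B), (C, D)) =
      (1 / 4) * ∑ P, ∑ Q, pauli i P A * pauli j D Q * Y (P, Q) (B, C) := by
  simp only [Matrix.mul_apply, Fintype.sum_prod_type, Matrix.kroneckerMap_apply, Vinv, midX,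
    Matrix.of_apply, Fin.sum_univ_two]
  fin_cases A <;> fin_cases D <;> simp <;> ring

lemma midX_mul_Vmat_kronecker_apply (Y : Matrix (Fin 2 × Fin 2) (Fin 2 × Fin 2) ℂ)
    (k l : Fin 4) (A B C D : Fin 2) :
    (midX Y * (Vmat ⊗ₖ Vmat)) ((A, B), (C, D)) (k, l) =
      ∑ P, ∑ Q, Y (B, C) (P, Q) * pauli k A P * pauli l Q D := by
  simp only [Matrix.mul_apply, Fintype.sum_prod_type, Matrix.kroneckerMap_apply, Vmat, midX,
    Matrix.of_apply, Fin.sum_univ_two]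
  fin_cases A <;> fin_cases D <;> simp <;> ring

lemma Rmat_eq (s t : ℂ) (hs : s * s = 1) :
    Rmat s 1 1 (fun p => !![0, 1; -1, 0] p.1 p.2) (fun p => !![0, -1; 1, 0] p.1 p.2) (twist t) =
      (Vinv ⊗ₖ Vinv) * midX (twist t) * (flipM ⊗ₖ flipM) *
        (midX (twist (-t)) * (Vmat ⊗ₖ Vmat)) := by
  have h : (s • flipM) ⊗ₖ ((1 : ℂ) • (flipM * (s • flipM) * flipM)) = flipM ⊗ₖ flipM := by
    rw [one_smul, Matrix.mul_smul, flipM_mul_flipM, Matrix.smul_mul, Matrix.one_mul,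
      Matrix.smul_kronecker, Matrix.kronecker_smul, smul_smul, hs, one_smul]
  rw [Rmat, Lmat_eq_smul_flipM, h, twist_inv, Matrix.mul_assoc _ (midX _) (Vmat ⊗ₖ Vmat)]

lemma Rmat_apply (s t : ℂ) (hs : s * s = 1) (i j k l : Fin 4) :
    Rmat s 1 1 (fun p => !![0, 1; -1, 0] p.1 p.2) (fun p => !![0, -1; 1, 0] p.1 p.2) (twist t)
        (i, j) (k, l) =
      (1 / 4) * ((pauli j * pauli k).trace * (pauli i * pauli l).trace
        + t * ((pauli i * pauli l) 0 1 * (pauli k * pauli j) 1 0)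
        - t * ((pauli j * pauli k) 0 1 * (pauli l * pauli i) 1 0)
        - t ^ 2 * (pauli i 0 0 * pauli j 0 0 * pauli k 1 1 * pauli l 1 1)) := by
  rw [Rmat_eq s t hs, Matrix.mul_apply]
  simp only [Fintype.sum_prod_type, mul_flipM_kronecker_apply, Vinv_kronecker_mul_midX_apply,
    midX_mul_Vmat_kronecker_apply]
  simp [Fin.sum_univ_two, twist, flipM, Matrix.single_apply, Matrix.trace, Matrix.mul_apply]
  ring

lemma Amat_eq (t : ℂ) (i : Fin 4) :
    Amat 1 !![0, 1; -1, 0] (twist t) i =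
      (![!![1 - t, 0; 0, 1], !![0, -1; -1, 0], !![0, I; -I, 0], !![-1 - t, 0; 0, 1]] :
        Fin 4 → Matrix (Fin 2) (Fin 2) ℂ) i := by
  rw [Amat, twist_inv]
  ext K L
  fin_cases i <;> fin_cases K <;> fin_cases L <;>
    simp [twist, flipM, pauli, Matrix.mul_apply, Fintype.sum_prod_type, Matrix.single_apply,
      Fin.sum_univ_two] <;> ring

lemma gam_mul_gam (a b t : ℂ) (i j : Fin 4) :
    gam a b 1 !![0, 1; -1, 0] (twist t) i * gam a b 1 !![0, 1; -1, 0] (twist t) j =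
      (a * b) • Matrix.fromBlocks (Amat 1 !![0, 1; -1, 0] (twist t) i * pauli j) 0 0
        (pauli i * Amat 1 !![0, 1; -1, 0] (twist t) j) := by
  simp [gam, Matrix.fromBlocks_multiply, Matrix.fromBlocks_smul, smul_smul, mul_comm]

set_option maxHeartbeats 8000000 in
lemma clifford_blocks (t : ℂ) (s : ℂ) (hs : s * s = 1) (i j : Fin 4) :
    Matrix.fromBlocks (Amat 1 !![0, 1; -1, 0] (twist t) i * pauli j) 0 0
        (pauli i * Amat 1 !![0, 1; -1, 0] (twist t) j) +
      ∑ k : Fin 4, ∑ l : Fin 4,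
        Rmat s 1 1 (fun p => !![0, 1; -1, 0] p.1 p.2) (fun p => !![0, -1; 1, 0] p.1 p.2)
            (twist t) (j, i) (l, k) •
          Matrix.fromBlocks (Amat 1 !![0, 1; -1, 0] (twist t) k * pauli l) 0 0
            (pauli k * Amat 1 !![0, 1; -1, 0] (twist t) l) =
      (2 * ((1 / 2 : ℂ) • !![2 - t, 0, 0, -t; 0, -2, 0, 0; 0, 0, -2, 0;
        -t, 0, 0, -2 - t]) j i) • (1 : Matrix (Fin 2 ⊕ Fin 2) (Fin 2 ⊕ Fin 2) ℂ) := by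
  simp only [Rmat_apply s t hs, Amat_eq, ← Matrix.fromBlocks_one, Matrix.fromBlocks_smul,
    Matrix.fromBlocks_add, Fin.sum_univ_four, smul_zero, add_zero]
  rw [Matrix.fromBlocks_inj]
  refine ⟨?_, rfl, rfl, ?_⟩
  all_goals
    ext K L
    fin_cases i <;> fin_cases j <;> fin_cases K <;> fin_cases L <;>
      simp [pauli, Matrix.trace] <;> ring_nf <;> try (simp only [I_sq]; ring)

/-- in case 2), for either s ∈ {1,-1}, the deformed Clifford relations
γ^i γ^j + Σ_{k,l} R^{ji}_{lk} γ^k γ^l = 2 g^{ji} 1₄ hold for all i,j iff ab = 1. -/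
theorem clifford_case2 (c : ℝ) (hc : c ≠ 0) (s : ℂ) (hs : s = 1 ∨ s = -1) (a b : ℂ) :
    (∀ i j : Fin 4,
        gam a b 1 !![0, 1; -1, 0]
            (flipM * toPair !![1, 0, 0, (c : ℂ)^2; 0, 1, 0, 0; 0, 0, 1, 0; 0, 0, 0, 1]) i *
          gam a b 1 !![0, 1; -1, 0]
            (flipM * toPair !![1, 0, 0, (c : ℂ)^2; 0, 1, 0, 0; 0, 0, 1, 0; 0, 0, 0, 1]) j +
        ∑ k : Fin 4, ∑ l : Fin 4,
          Rmat s 1 1 (fun p => !![0, 1; -1, 0] p.1 p.2) (fun p => !![0, -1; 1, 0] p.1 p.2)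
              (flipM * toPair !![1, 0, 0, (c : ℂ)^2; 0, 1, 0, 0; 0, 0, 1, 0; 0, 0, 0, 1])
              (j, i) (l, k) •
            (gam a b 1 !![0, 1; -1, 0]
                (flipM * toPair !![1, 0, 0, (c : ℂ)^2; 0, 1, 0, 0; 0, 0, 1, 0; 0, 0, 0, 1]) k *
              gam a b 1 !![0, 1; -1, 0]
                (flipM * toPair !![1, 0, 0, (c : ℂ)^2; 0, 1, 0, 0; 0, 0, 1, 0; 0, 0, 0, 1]) l)
        = (2 * ((1 / 2 : ℂ) • !![2 - (c : ℂ)^2, 0, 0, -(c : ℂ)^2; 0, -2, 0, 0; 0, 0, -2, 0;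
              -(c : ℂ)^2, 0, 0, -2 - (c : ℂ)^2]) j i) •
            (1 : Matrix (Fin 2 ⊕ Fin 2) (Fin 2 ⊕ Fin 2) ℂ))
      ↔ a * b = 1 := by
  simp only [flipM_mul_toPair, gam_mul_gam]
  have hs2 : s * s = 1 := by rcases hs with rfl | rfl <;> norm_num
  have key : ∀ i j : Fin 4, _ := fun i j =>
    congrArg ((a * b) • ·) (clifford_blocks ((c : ℂ) ^ 2) s hs2 i j)
  simp only [smul_add, Finset.smul_sum, smul_comm (a * b)] at key
  simp only [key]
  constructor
  · intro h
    have := congrFun (congrFun (h 1 1) (Sum.inl 0)) (Sum.inl 0)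
    simpa using this
  · intro h i j
    rw [h, one_smul]
end
end

section
/- In case 3), let g = -(1/2)·[[(r+1)c²-2, 0, -2ic, (1+r)c²], [0, 2, 0, 0], [2ic, 0, 2, 2ic], [(1+r)c², 0, -2ic, (r+1)c²+2]] and let R be defined as above (for either value of s ∈ {1,-1}; R does not depend on s). For a,b ∈ ℂ, the deformed Clifford relations γ^i γ^j + Σ_{k,l=0}^{3} R^{ji}_{lk} γ^k γ^l = 2 g^{ji}·1₄ hold for all i,j ∈ {0,1,2,3} if and only if ab = 1. -/
open Matrix Complex Kronecker

noncomputable section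

/-- The matrix replacing `Aᵢ` when `σᵢ` is replaced by the matrix unit `E_{BA}`, for `q = 1`. -/
def unitA (E : Matrix (Fin 2) (Fin 2) ℂ) (X : Matrix (Fin 2 × Fin 2) (Fin 2 × Fin 2) ℂ)
    (A B : Fin 2) : Matrix (Fin 2) (Fin 2) ℂ :=
  E.transpose * (Matrix.of fun K L => (flipM * X⁻¹ * flipM) (B, A) (K, L)) * E

theorem Amat_one_eq_sum (E : Matrix (Fin 2) (Fin 2) ℂ)
    (X : Matrix (Fin 2 × Fin 2) (Fin 2 × Fin 2) ℂ) (i : Fin 4) :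
    Amat 1 E X i = ∑ A : Fin 2, ∑ B : Fin 2, pauli i B A • unitA E X A B := by
  ext x y
  simp only [Amat, unitA, Matrix.smul_apply, Matrix.mul_apply, Matrix.of_apply, Fin.sum_univ_two,
    Matrix.transpose_apply, Matrix.add_apply, smul_eq_mul]
  ring

theorem Vmat_mul_Vinv : Vmat * Vinv = 1 := by
  ext ⟨A, B⟩ ⟨C, D⟩
  fin_cases A <;> fin_cases B <;> fin_cases C <;> fin_cases D <;>
    simp [Vmat, Vinv, pauli, Matrix.mul_apply, Fin.sum_univ_four] <;>
    ring_nf <;> norm_num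

theorem midX_mul (Y Z : Matrix (Fin 2 × Fin 2) (Fin 2 × Fin 2) ℂ) :
    midX Y * midX Z = midX (Y * Z) := by
  ext ⟨⟨A, B⟩, ⟨C, D⟩⟩ ⟨⟨A', B'⟩, ⟨C', D'⟩⟩
  fin_cases A <;> fin_cases D <;> fin_cases A' <;> fin_cases D' <;>
    simp [midX, Matrix.mul_apply, Fintype.sum_prod_type, Fin.sum_univ_two]

theorem midX_one : midX 1 = 1 := by
  ext ⟨⟨A, B⟩, ⟨C, D⟩⟩ ⟨⟨A', B'⟩, ⟨C', D'⟩⟩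
  simp only [midX, Matrix.of_apply, Matrix.one_apply, Prod.mk.injEq]
  split_ifs <;> simp_all

theorem kronecker_mulVec_mul {m n : Type*} [Fintype m] [Fintype n]
    (A : Matrix m m ℂ) (B : Matrix n n ℂ) (f : m → ℂ) (g : n → ℂ) :
    (A ⊗ₖ B) *ᵥ (fun p => f p.1 * g p.2) = fun p => (A *ᵥ f) p.1 * (B *ᵥ g) p.2 := by
  ext ⟨i, j⟩
  simp only [Matrix.mulVec, dotProduct, Matrix.kroneckerMap_apply, Fintype.sum_prod_type,
    Finset.sum_mul_sum]
  exact Finset.sum_congr rfl fun _ _ => Finset.sum_congr rfl fun _ _ => by ring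

theorem Lmat_mulVec (s : ℂ) (Ev Ep v : Fin 2 × Fin 2 → ℂ) :
    Lmat s 1 1 Ev Ep *ᵥ v = s • (v + (Ep ⬝ᵥ v) • Ev) := by
  ext p
  simp only [Lmat, Matrix.mulVec, dotProduct, Matrix.of_apply, Pi.smul_apply, Pi.add_apply,
    smul_eq_mul, mul_one, one_mul, mul_assoc, add_mul, ite_mul, zero_mul, mul_add,
    Finset.sum_add_distrib, ← Finset.mul_sum, Finset.sum_ite_eq, Finset.mem_univ, if_true]
  ring

theorem flipM_mulVec (v : Fin 2 × Fin 2 → ℂ) : flipM *ᵥ v = fun p => v p.swap := by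
  ext ⟨A, B⟩
  fin_cases A <;> fin_cases B <;>
    simp [flipM, Matrix.mulVec, dotProduct, Fintype.sum_prod_type, Fin.sum_univ_two]

theorem flipM_Lmat_mulVec (s : ℂ) (Ev Ep v : Fin 2 × Fin 2 → ℂ) :
    ((1 : ℂ) • (flipM * Lmat s 1 1 Ev Ep * flipM)) *ᵥ v =
      s • (v + (∑ p, Ep p * v p.swap) • fun p => Ev p.swap) := by
  rw [one_smul, ← Matrix.mulVec_mulVec, ← Matrix.mulVec_mulVec, Lmat_mulVec, flipM_mulVec,
    flipM_mulVec]
  ext p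
  simp [dotProduct]

/-- The matrix `(V⁻¹⊗V⁻¹)(1₂⊗X⊗1₂)` conjugating `L ⊗ L̃` into `R`. -/
def conjP (X : Matrix (Fin 2 × Fin 2) (Fin 2 × Fin 2) ℂ) :
    Matrix (Fin 4 × Fin 4) ((Fin 2 × Fin 2) × (Fin 2 × Fin 2)) ℂ :=
  (Vinv ⊗ₖ Vinv) * midX X

theorem Rmat_mul_conjP (s : ℂ) (Ev Ep : Fin 2 × Fin 2 → ℂ)
    (X : Matrix (Fin 2 × Fin 2) (Fin 2 × Fin 2) ℂ) (hX : X⁻¹ * X = 1) :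
    Rmat s 1 1 Ev Ep X * conjP X = conjP X *
      (Lmat s 1 1 Ev Ep ⊗ₖ ((1 : ℂ) • (flipM * Lmat s 1 1 Ev Ep * flipM))) := by
  have h : midX X⁻¹ * (Vmat ⊗ₖ Vmat) * ((Vinv ⊗ₖ Vinv) * midX X) = 1 := by
    rw [Matrix.mul_assoc, ← Matrix.mul_assoc (Vmat ⊗ₖ Vmat), ← Matrix.mul_kronecker_mul,
      Vmat_mul_Vinv, Matrix.one_kronecker_one, Matrix.one_mul, midX_mul, hX, midX_one]
  rw [Rmat, conjP, Matrix.mul_assoc _ (midX X⁻¹), Matrix.mul_assoc _ (midX X⁻¹ * _), h,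
    Matrix.mul_one]

theorem conjP_mulVec_apply (X : Matrix (Fin 2 × Fin 2) (Fin 2 × Fin 2) ℂ)
    (u : (Fin 2 × Fin 2) × (Fin 2 × Fin 2) → ℂ) (j i : Fin 4) :
    (conjP X *ᵥ u) (j, i) = 1 / 4 * ∑ A : Fin 2, ∑ B : Fin 2, ∑ C : Fin 2, ∑ D : Fin 2,
      pauli j B A * pauli i D C *
        ∑ B' : Fin 2, ∑ C' : Fin 2, X (B, C) (B', C') * u ((A, B'), (C', D)) := by
  have h (A B C D : Fin 2) : (midX X *ᵥ u) ((A, B), (C, D)) =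
      ∑ B' : Fin 2, ∑ C' : Fin 2, X (B, C) (B', C') * u ((A, B'), (C', D)) := by
    fin_cases A <;> fin_cases D <;>
      simp [midX, Matrix.mulVec, dotProduct, Fintype.sum_prod_type, Fin.sum_univ_two]
  rw [conjP, ← Matrix.mulVec_mulVec, Matrix.mulVec, dotProduct]
  simp only [Fintype.sum_prod_type, h, Matrix.kroneckerMap_apply, Vinv, Matrix.of_apply,
    Finset.mul_sum _ _ (1 / 4 : ℂ)]
  refine Finset.sum_congr rfl fun _ _ => Finset.sum_congr rfl fun _ _ =>
    Finset.sum_congr rfl fun _ _ => Finset.sum_congr rfl fun _ _ => ?_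
  ring

theorem mul_add_sum_mul_eq (R : Matrix (Fin 4 × Fin 4) (Fin 4 × Fin 4) ℂ)
    (w : Fin 4 × Fin 4 → ℂ) (z : ℂ) (j i : Fin 4) :
    z * w (j, i) + ∑ k : Fin 4, ∑ l : Fin 4, R (j, i) (l, k) * (z * w (l, k)) =
      z * (w + R *ᵥ w) (j, i) := by
  simp only [Pi.add_apply, Matrix.mulVec, dotProduct, Fintype.sum_prod_type_right, mul_add,
    Finset.mul_sum, mul_left_comm z]

section Clifford

variable {s : ℂ} {E E' : Matrix (Fin 2) (Fin 2) ℂ}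
  {X : Matrix (Fin 2 × Fin 2) (Fin 2 × Fin 2) ℂ}

theorem add_Rmat_mulVec_left (hs : s * s = 1) (hX : X⁻¹ * X = 1)
    (hEE : ∑ p : Fin 2 × Fin 2, E' p.1 p.2 * E p.1 p.2 = -2) (v : Fin 2 × Fin 2 → ℂ) :
    conjP X *ᵥ (fun p => E p.1.1 p.1.2 * v p.2) +
        Rmat s 1 1 (fun p => E p.1 p.2) (fun p => E' p.1 p.2) X *ᵥ
          (conjP X *ᵥ (fun p => E p.1.1 p.1.2 * v p.2)) =
      (-∑ p : Fin 2 × Fin 2, E' p.1 p.2 * v p.swap) •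
        (conjP X *ᵥ fun p => E p.1.1 p.1.2 * E p.2.2 p.2.1) := by
  rw [Matrix.mulVec_mulVec, Rmat_mul_conjP _ _ _ _ hX, ← Matrix.mulVec_mulVec,
    kronecker_mulVec_mul _ _ (fun p : Fin 2 × Fin 2 => E p.1 p.2), Lmat_mulVec, flipM_Lmat_mulVec,
    ← Matrix.mulVec_add, ← Matrix.mulVec_smul]
  congr 1
  ext p
  simp only [dotProduct, hEE, Pi.add_apply, Pi.smul_apply, smul_eq_mul, Prod.fst_swap,
    Prod.snd_swap]
  linear_combination (-(E p.1.1 p.1.2) * (v p.2 +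
    (∑ p : Fin 2 × Fin 2, E' p.1 p.2 * v p.swap) * E p.2.2 p.2.1)) * hs

theorem add_Rmat_mulVec_right (hs : s * s = 1) (hX : X⁻¹ * X = 1)
    (hEE : ∑ p : Fin 2 × Fin 2, E' p.1 p.2 * E p.1 p.2 = -2) (v : Fin 2 × Fin 2 → ℂ) :
    conjP X *ᵥ (fun p => v p.1 * E p.2.2 p.2.1) +
        Rmat s 1 1 (fun p => E p.1 p.2) (fun p => E' p.1 p.2) X *ᵥ
          (conjP X *ᵥ (fun p => v p.1 * E p.2.2 p.2.1)) =
      (-∑ p : Fin 2 × Fin 2, E' p.1 p.2 * v p) •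
        (conjP X *ᵥ fun p => E p.1.1 p.1.2 * E p.2.2 p.2.1) := by
  rw [Matrix.mulVec_mulVec, Rmat_mul_conjP _ _ _ _ hX, ← Matrix.mulVec_mulVec,
    kronecker_mulVec_mul _ _ v (fun p : Fin 2 × Fin 2 => E p.2 p.1), Lmat_mulVec, flipM_Lmat_mulVec,
    ← Matrix.mulVec_add, ← Matrix.mulVec_smul]
  congr 1
  ext p
  simp only [dotProduct, hEE, Pi.add_apply, Pi.smul_apply, smul_eq_mul, Prod.fst_swap,
    Prod.snd_swap]
  linear_combination (-(E p.2.2 p.2.1) * (v p.1 +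
    (∑ p : Fin 2 × Fin 2, E' p.1 p.2 * v p) * E p.1.1 p.1.2)) * hs

theorem pauli_mul_Amat_apply
    (hM : ∀ A B C y, unitA E X A B C y =
      ∑ B' : Fin 2, ∑ C' : Fin 2, X (B, C) (B', C') * (E A B' * E C' y))
    (i j : Fin 4) (x y : Fin 2) :
    (pauli i * Amat 1 E X j) x y =
      4 * (conjP X *ᵥ fun p => E p.1.1 p.1.2 *
        (E p.2.1 y * if x = p.2.2 then 1 else 0)) (j, i) := by
  rw [conjP_mulVec_apply, Amat_one_eq_sum]
  fin_cases x <;>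
    simp [hM, Matrix.mul_apply, Fin.sum_univ_two, Matrix.add_apply] <;> ring

theorem Amat_mul_pauli_apply
    (hM : ∀ C D x B, unitA E X C D x B =
      ∑ B' : Fin 2, ∑ C' : Fin 2, X (B, C) (B', C') * (E B' x * E D C'))
    (i j : Fin 4) (x y : Fin 2) :
    (Amat 1 E X i * pauli j) x y =
      4 * (conjP X *ᵥ fun p => (if p.1.1 = y then 1 else 0) * E p.1.2 x *
        E p.2.2 p.2.1) (j, i) := by
  rw [conjP_mulVec_apply, Amat_one_eq_sum]
  fin_cases y <;>
    simp [hM, Matrix.mul_apply, Fin.sum_univ_two, Matrix.add_apply] <;> ring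

theorem gam_mul_apply_inl_inr (a b : ℂ) (i j : Fin 4) (x y : Fin 2) :
    (gam a b 1 E X i * gam a b 1 E X j) (.inl x) (.inr y) = 0 := by
  simp [gam, Matrix.fromBlocks_multiply]

theorem gam_mul_apply_inr_inl (a b : ℂ) (i j : Fin 4) (x y : Fin 2) :
    (gam a b 1 E X i * gam a b 1 E X j) (.inr x) (.inl y) = 0 := by
  simp [gam, Matrix.fromBlocks_multiply]

theorem gam_mul_apply_inl_inl (a b : ℂ) (i j : Fin 4) (x y : Fin 2) :
    (gam a b 1 E X i * gam a b 1 E X j) (.inl x) (.inl y) =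
      a * b * (Amat 1 E X i * pauli j) x y := by
  simp [gam, Matrix.fromBlocks_multiply, mul_assoc]

theorem gam_mul_apply_inr_inr (a b : ℂ) (i j : Fin 4) (x y : Fin 2) :
    (gam a b 1 E X i * gam a b 1 E X j) (.inr x) (.inr y) =
      a * b * (pauli i * Amat 1 E X j) x y := by
  simp [gam, Matrix.fromBlocks_multiply, mul_assoc, mul_left_comm]

/-- The deformed anticommutator of the gamma matrices is a multiple of the identity. -/
theorem gam_mul_add_sum_Rmat (hs : s * s = 1) (hX : X⁻¹ * X = 1)
    (hEE : ∑ p : Fin 2 × Fin 2, E' p.1 p.2 * E p.1 p.2 = -2) (hE : E' * E = 1)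
    (hM : ∀ A B C y, unitA E X A B C y =
      ∑ B' : Fin 2, ∑ C' : Fin 2, X (B, C) (B', C') * (E A B' * E C' y))
    (hM' : ∀ C D x B, unitA E X C D x B =
      ∑ B' : Fin 2, ∑ C' : Fin 2, X (B, C) (B', C') * (E B' x * E D C'))
    (a b : ℂ) (i j : Fin 4) :
    gam a b 1 E X i * gam a b 1 E X j + ∑ k : Fin 4, ∑ l : Fin 4,
        Rmat s 1 1 (fun p => E p.1 p.2) (fun p => E' p.1 p.2) X (j, i) (l, k) •
          (gam a b 1 E X k * gam a b 1 E X l) =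
      (a * b * (-4 * (conjP X *ᵥ fun p => E p.1.1 p.1.2 * E p.2.2 p.2.1) (j, i))) •
        (1 : Matrix (Fin 2 ⊕ Fin 2) (Fin 2 ⊕ Fin 2) ℂ) := by
  have hE' (x y : Fin 2) : ∑ B, E' x B * E B y = if x = y then 1 else 0 := by
    rw [← Matrix.mul_apply, hE, Matrix.one_apply]
  have hr (x y : Fin 2) : ∑ p : Fin 2 × Fin 2,
      E' p.1 p.2 * ((if p.1 = y then 1 else 0) * E p.2 x) = if x = y then 1 else 0 := by
    simp [Fintype.sum_prod_type_right, hE', eq_comm]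
  have hl (x y : Fin 2) : ∑ p : Fin 2 × Fin 2,
      E' p.1 p.2 * (E p.swap.1 y * if x = p.swap.2 then 1 else 0) = if x = y then 1 else 0 := by
    simp [Fintype.sum_prod_type_right, hE']
  ext x y
  rcases x with x | x <;> rcases y with y | y <;>
    simp only [Matrix.add_apply, Matrix.sum_apply, Matrix.smul_apply, smul_eq_mul,
      gam_mul_apply_inl_inr, gam_mul_apply_inr_inl, gam_mul_apply_inl_inl, gam_mul_apply_inr_inr,
      Amat_mul_pauli_apply hM', pauli_mul_Amat_apply hM, mul_zero, Finset.sum_const_zero]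
  · simp only [← mul_assoc (a * b) 4]
    rw [mul_add_sum_mul_eq, add_Rmat_mulVec_right hs hX hEE
      fun p => (if p.1 = y then 1 else 0) * E p.2 x]
    simp only [Pi.smul_apply, smul_eq_mul, hr, Matrix.one_apply, Sum.inl.injEq]
    ring
  · simp
  · simp
  · simp only [← mul_assoc (a * b) 4]
    rw [mul_add_sum_mul_eq, add_Rmat_mulVec_left hs hX hEE
      fun p => E p.1 y * if x = p.2 then 1 else 0]
    simp only [Pi.smul_apply, smul_eq_mul, hl, Matrix.one_apply, Sum.inr.injEq]
    ring

end Clifford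

/-- The flip composed with the unipotent matrix whose corner entry is `ρ`. -/
def twistX (ρ : ℂ) : Matrix (Fin 2 × Fin 2) (Fin 2 × Fin 2) ℂ :=
  flipM * toPair !![1, 0, 0, ρ; 0, 1, 0, 0; 0, 0, 1, 0; 0, 0, 0, 1]

theorem twistX_mul (ρ : ℂ) : twistX ρ *
    (toPair !![1, 0, 0, -ρ; 0, 1, 0, 0; 0, 0, 1, 0; 0, 0, 0, 1] * flipM) = 1 := by
  ext ⟨A, B⟩ ⟨C, D⟩
  fin_cases A <;> fin_cases B <;> fin_cases C <;> fin_cases D <;>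
    simp [twistX, flipM, toPair, pidx, Matrix.mul_apply, Fintype.sum_prod_type]

theorem twistX_inv (ρ : ℂ) : (twistX ρ)⁻¹ =
    toPair !![1, 0, 0, -ρ; 0, 1, 0, 0; 0, 0, 1, 0; 0, 0, 0, 1] * flipM :=
  Matrix.inv_eq_right_inv (twistX_mul ρ)

theorem twistX_inv_mul (ρ : ℂ) : (twistX ρ)⁻¹ * twistX ρ = 1 :=
  Matrix.nonsing_inv_mul _ (Matrix.isUnit_det_of_right_inverse (twistX_mul ρ))

theorem sum_twistX_mul (ρ : ℂ) (B C : Fin 2) (f : Fin 2 → Fin 2 → ℂ) :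
    ∑ B' : Fin 2, ∑ C' : Fin 2, twistX ρ (B, C) (B', C') * f B' C' =
      f C B + if B = 0 ∧ C = 0 then ρ * f 1 1 else 0 := by
  fin_cases B <;> fin_cases C <;>
    simp [twistX, flipM, toPair, pidx, Matrix.mul_apply, Fintype.sum_prod_type]

theorem unitA_twistX (ρ c : ℂ) (A B C D : Fin 2) :
    unitA !![c, 1; -1, 0] (twistX ρ) A B C D =
      !![c, 1; -1, 0] A C * !![c, 1; -1, 0] B D +
        if B = 0 ∧ C = 0 then
          ρ * (!![c, 1; -1, 0] A 1 * !![c, 1; -1, 0] 1 D) else 0 := by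
  rw [unitA, twistX_inv]
  fin_cases A <;> fin_cases B <;> fin_cases C <;> fin_cases D <;>
    simp [flipM, toPair, pidx, Matrix.mul_apply, Fintype.sum_prod_type]

theorem conjP_twistX_mulVec (r c : ℂ) (i j : Fin 4) :
    -4 * (conjP (twistX (r * c ^ 2)) *ᵥ fun p =>
        !![c, 1; -1, 0] p.1.1 p.1.2 * !![c, 1; -1, 0] p.2.2 p.2.1) (j, i) =
      2 * ((-(1 / 2) : ℂ) •
        !![(r + 1) * c ^ 2 - 2, 0, -2 * I * c, (1 + r) * c ^ 2;
           0, 2, 0, 0;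
           2 * I * c, 0, 2, 2 * I * c;
           (1 + r) * c ^ 2, 0, -2 * I * c, (r + 1) * c ^ 2 + 2]) j i := by
  simp only [conjP_mulVec_apply, sum_twistX_mul _ _ _ fun B' C' =>
    !![c, 1; -1, 0] _ B' * !![c, 1; -1, 0] _ C']
  fin_cases i <;> fin_cases j <;>
    simp [pauli] <;> ring_nf

/-- in case 3), for either s ∈ {1,-1}, the deformed Clifford relations
γ^i γ^j + Σ_{k,l} R^{ji}_{lk} γ^k γ^l = 2 g^{ji} 1₄ hold for all i,j iff ab = 1. -/
theorem clifford_case3 (c r : ℝ) (hc : c ≠ 0) (hr : 0 ≤ r)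
    (s : ℂ) (hs : s = 1 ∨ s = -1) (a b : ℂ) :
    (∀ i j : Fin 4,
        gam a b 1 !![(c : ℂ), 1; -1, 0]
            (flipM * toPair !![1, 0, 0, (r : ℂ) * (c : ℂ)^2; 0, 1, 0, 0; 0, 0, 1, 0;
              0, 0, 0, 1]) i *
          gam a b 1 !![(c : ℂ), 1; -1, 0]
            (flipM * toPair !![1, 0, 0, (r : ℂ) * (c : ℂ)^2; 0, 1, 0, 0; 0, 0, 1, 0;
              0, 0, 0, 1]) j +
        ∑ k : Fin 4, ∑ l : Fin 4,
          Rmat s 1 1 (fun p => !![(c : ℂ), 1; -1, 0] p.1 p.2)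
              (fun p => !![0, -1; 1, (c : ℂ)] p.1 p.2)
              (flipM * toPair !![1, 0, 0, (r : ℂ) * (c : ℂ)^2; 0, 1, 0, 0; 0, 0, 1, 0;
                0, 0, 0, 1])
              (j, i) (l, k) •
            (gam a b 1 !![(c : ℂ), 1; -1, 0]
                (flipM * toPair !![1, 0, 0, (r : ℂ) * (c : ℂ)^2; 0, 1, 0, 0; 0, 0, 1, 0;
                  0, 0, 0, 1]) k *
              gam a b 1 !![(c : ℂ), 1; -1, 0]
                (flipM * toPair !![1, 0, 0, (r : ℂ) * (c : ℂ)^2; 0, 1, 0, 0; 0, 0, 1, 0;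
                  0, 0, 0, 1]) l)
        = (2 * ((-(1 / 2) : ℂ) •
            !![((r : ℂ) + 1) * (c : ℂ)^2 - 2, 0, -2 * I * (c : ℂ), (1 + (r : ℂ)) * (c : ℂ)^2;
               0, 2, 0, 0;
               2 * I * (c : ℂ), 0, 2, 2 * I * (c : ℂ);
               (1 + (r : ℂ)) * (c : ℂ)^2, 0, -2 * I * (c : ℂ),
                 ((r : ℂ) + 1) * (c : ℂ)^2 + 2]) j i) •
            (1 : Matrix (Fin 2 ⊕ Fin 2) (Fin 2 ⊕ Fin 2) ℂ))
      ↔ a * b = 1 := by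
  have hss : s * s = 1 := by rcases hs with rfl | rfl <;> norm_num
  have hEE : ∑ p : Fin 2 × Fin 2, !![0, -1; 1, (c : ℂ)] p.1 p.2 *
      !![(c : ℂ), 1; -1, 0] p.1 p.2 = -2 := by
    simp [Fintype.sum_prod_type]
    norm_num
  have hE : !![0, -1; 1, (c : ℂ)] * !![(c : ℂ), 1; -1, 0] = 1 := by
    ext i j
    fin_cases i <;> fin_cases j <;> simp [Matrix.mul_apply]
  have key := gam_mul_add_sum_Rmat hss (twistX_inv_mul (r * c ^ 2)) hEE hE
    (by
      intro A B C y
      rw [unitA_twistX, sum_twistX_mul _ _ _ fun B' C' =>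
        !![(c : ℂ), 1; -1, 0] A B' * !![(c : ℂ), 1; -1, 0] C' y])
    (by
      intro C D x B
      rw [unitA_twistX, sum_twistX_mul _ _ _ fun B' C' =>
        !![(c : ℂ), 1; -1, 0] B' x * !![(c : ℂ), 1; -1, 0] D C']
      fin_cases C <;> fin_cases D <;> fin_cases x <;> fin_cases B <;> simp) a b
  simp only [conjP_twistX_mulVec] at key
  rw [twistX] at key
  simp only [key]
  constructor
  · intro h
    simpa using congrFun (congrFun (h 1 1) (.inl 0)) (.inl 0)
  · intro h i j
    rw [h, one_mul]
end
end
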